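/- With the worst-case construction, for each ℓ ≥ 1 the cost vector c^ℓ induces a strict total order on the 2k points: if ℓ = 1, c¹·y^{2k} < c¹·y^{2k-1} < ⋯ < c¹·y¹; if ℓ ≥ 2 is even, c^ℓ·y¹ < c^ℓ·y^{2k} < c^ℓ·y^{2k-1} < ⋯ < c^ℓ·y^{k+1}; if ℓ ≥ 3 is odd, c^ℓ·y^{k+1} < c^ℓ·y^k < ⋯ < c^ℓ·y¹. In particular, for each ℓ there is a chain of at least k points with strictly increasing c^ℓ-value, each consecutive pair differing by exactly 1. -/

import Mathlib

/-- The points `y^j ∈ {0,1}^{8k-2}` of the bit-scaling worst-case construction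
(coordinates are indexed `1, …, 8k-2`; the four blocks have sizes
`k-1`, `k-1`, `3k`, `3k`). -/
def yvec (k j : ℕ) (i : Fin (8 * k - 2)) : ℤ :=
  let i' := (i : ℕ) + 1
  let j' := if j ≤ k then j else j - k
  if i' ≤ k - 1 then (if j' ≤ i' then 1 else 0)
  else if i' ≤ 2 * k - 2 then (if i' - (k - 1) < j' then 1 else 0)
  else if i' ≤ 5 * k - 2 then (if j ≤ k then 1 else 0)
  else (if j ≤ k then 0 else 1)

/-- The 0/1 layers `d^ℓ` of the cost vectors of the worst-case construction. -/
def dvec (k l : ℕ) (i : Fin (8 * k - 2)) : ℤ :=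
  let i' := (i : ℕ) + 1
  if l = 1 then
    if i' ≤ k - 1 then 1
    else if i' ≤ 2 * k - 2 then 0
    else if i' ≤ 3 * k - 2 then 1
    else 0
  else
    if i' ≤ k - 1 then 0
    else if i' ≤ 2 * k - 2 then 1
    else if i' ≤ 5 * k - 2 then (if Odd l then 1 else 0)
    else (if Even l then 1 else 0)

/-- The cost vectors `c^ℓ` with `c⁰ = 0` and `c^ℓ = 2c^{ℓ-1} + d^ℓ`. -/
def cvec (k : ℕ) : ℕ → Fin (8 * k - 2) → ℤ
  | 0 => fun _ => 0
  | l + 1 => fun i => 2 * cvec k l i + dvec k (l + 1) i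

/-- Each cost vector is constant on the blocks of coordinates; the block values obey a parity
dependent linear relation. -/
theorem cvec_blocks (k l : ℕ) : ∃ P A B : ℤ,
    (∀ i, cvec k (l + 1) i =
      if (i : ℕ) + 1 ≤ k - 1 then P
      else if (i : ℕ) + 1 ≤ 2 * k - 2 then P - 1
      else if (i : ℕ) + 1 ≤ 3 * k - 2 then P + A
      else if (i : ℕ) + 1 ≤ 5 * k - 2 then A
      else B) ∧
    (Odd (l + 1) → 3 * (B - A) = P - 1) ∧ (Even (l + 1) → 3 * (B - A) = P + 1) := by
  induction l with
  | zero =>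
    refine ⟨1, 0, 0, fun i => ?_, by norm_num, by norm_num⟩
    simp only [cvec, dvec]
    split_ifs <;> rfl
  | succ l ih =>
    obtain ⟨P, A, B, h, ho, he⟩ := ih
    rcases Nat.even_or_odd (l + 1) with hp | hp
    · have hn : Odd (l + 1 + 1) := hp.add_one
      have hn' : ¬ Even (l + 1 + 1) := Nat.not_even_iff_odd.2 hn
      have hd := he hp
      refine ⟨2 * P, 2 * A + 1, 2 * B, fun i => ?_, fun _ => by linarith, fun c => absurd c hn'⟩
      change 2 * cvec k (l + 1) i + dvec k (l + 1 + 1) i = _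
      rw [h i]
      simp only [dvec, hn, hn', if_true, if_false]
      split_ifs <;> omega
    · have hn : Even (l + 1 + 1) := hp.add_one
      have hn' : ¬ Odd (l + 1 + 1) := Nat.not_odd_iff_even.2 hn
      have hd := ho hp
      refine ⟨2 * P, 2 * A, 2 * B + 1, fun i => ?_, fun c => absurd c hn', fun _ => by linarith⟩
      change 2 * cvec k (l + 1) i + dvec k (l + 1 + 1) i = _
      rw [h i]
      simp only [dvec, hn, hn', if_true, if_false]
      split_ifs <;> omega

theorem Finset.sum_range_of_eq_const (f : ℕ → ℤ) (s n : ℕ) (c : ℤ)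
    (h : ∀ x < n, f (s + x) = c) : ∑ x ∈ Finset.range n, f (s + x) = n * c := by
  rw [Finset.sum_congr rfl fun x hx => h x (Finset.mem_range.1 hx)]
  simp

/-- The cost of `y^j` for a block-constant cost vector. Here `a + 1` is the index of `y^j` within
its half, and `k = a + b + 1`. -/
theorem sum_blocks_mul_yvec (k j a b : ℕ) (P A B : ℤ) (c : Fin (8 * k - 2) → ℤ)
    (hc : ∀ i, c i =
      if (i : ℕ) + 1 ≤ k - 1 then P
      else if (i : ℕ) + 1 ≤ 2 * k - 2 then P - 1
      else if (i : ℕ) + 1 ≤ 3 * k - 2 then P + A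
      else if (i : ℕ) + 1 ≤ 5 * k - 2 then A
      else B)
    (hk : k = a + b + 1) (hj : (if j ≤ k then j else j - k) = a + 1) :
    ∑ i, c i * yvec k j i =
      P * (k - 1) - a + if j ≤ k then k * P + 3 * k * A else 3 * k * B := by
  let f : ℕ → ℤ := fun i =>
    (if i + 1 ≤ k - 1 then P
      else if i + 1 ≤ 2 * k - 2 then P - 1
      else if i + 1 ≤ 3 * k - 2 then P + A
      else if i + 1 ≤ 5 * k - 2 then A
      else B) *
    (if i + 1 ≤ k - 1 then (if a + 1 ≤ i + 1 then 1 else 0)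
      else if i + 1 ≤ 2 * k - 2 then (if i + 1 - (k - 1) < a + 1 then 1 else 0)
      else if i + 1 ≤ 5 * k - 2 then (if j ≤ k then 1 else 0)
      else (if j ≤ k then 0 else 1))
  have hf : ∀ i, c i * yvec k j i = f i := by
    intro i
    simp only [hc, yvec, hj, f]
  have hn : 8 * k - 2 = 0 + a + b + a + b + k + 2 * k + 3 * k := by omega
  rw [Finset.sum_congr rfl fun i _ => hf i, Fin.sum_univ_eq_sum_range f, hn]
  simp only [Finset.sum_range_add, Finset.sum_range_zero]
  rw [Finset.sum_range_of_eq_const f _ a 0, Finset.sum_range_of_eq_const f _ b P,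
    Finset.sum_range_of_eq_const f _ a (P - 1), Finset.sum_range_of_eq_const f _ b 0,
    Finset.sum_range_of_eq_const f _ k (if j ≤ k then P + A else 0),
    Finset.sum_range_of_eq_const f _ (2 * k) (if j ≤ k then A else 0),
    Finset.sum_range_of_eq_const f _ (3 * k) (if j ≤ k then 0 else B)]
  · subst hk
    push_cast
    split_ifs <;> ring
  all_goals
    intro x hx
    simp only [f]
    clear hc hf hj hn
    split_ifs <;> omega

/-- for each `ℓ ≥ 1` the cost vector `c^ℓ` induces a strict order on the
`2k` points: if `ℓ = 1` then `c¹·y^{2k} < ⋯ < c¹·y¹`; if `ℓ ≥ 2` is even then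
`c^ℓ·y¹ < c^ℓ·y^{2k} < ⋯ < c^ℓ·y^{k+1}`; if `ℓ ≥ 3` is odd then
`c^ℓ·y^{k+1} < c^ℓ·y^k < ⋯ < c^ℓ·y¹`. -/
theorem stmt13 (k : ℕ) (hk : 1 ≤ k) (l : ℕ) (hl : 1 ≤ l) :
    (l = 1 → ∀ j, 1 ≤ j → j ≤ 2 * k - 1 →
      ∑ i, cvec k l i * yvec k (j + 1) i < ∑ i, cvec k l i * yvec k j i) ∧
    (2 ≤ l → Even l →
      (∑ i, cvec k l i * yvec k 1 i < ∑ i, cvec k l i * yvec k (2 * k) i) ∧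
      ∀ j, k + 1 ≤ j → j ≤ 2 * k - 1 →
        ∑ i, cvec k l i * yvec k (j + 1) i < ∑ i, cvec k l i * yvec k j i) ∧
    (2 ≤ l → Odd l →
      (∑ i, cvec k l i * yvec k (k + 1) i < ∑ i, cvec k l i * yvec k k i) ∧
      ∀ j, 1 ≤ j → j ≤ k - 1 →
        ∑ i, cvec k l i * yvec k (j + 1) i < ∑ i, cvec k l i * yvec k j i) := by
  obtain ⟨l, rfl⟩ : ∃ m, l = m + 1 := ⟨l - 1, by omega⟩
  obtain ⟨P, A, B, hc, ho, he⟩ := cvec_blocks k l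
  have low : ∀ j, 1 ≤ j → j ≤ k → ∑ i, cvec k (l + 1) i * yvec k j i =
      P * (k - 1) - (j - 1) + (k * P + 3 * k * A) := by
    intro j h1 h2
    rw [sum_blocks_mul_yvec k j (j - 1) (k - j) P A B _ hc (by omega) (by rw [if_pos h2]; omega),
      if_pos h2]
    push_cast [h1]
    ring
  have high : ∀ j, k + 1 ≤ j → j ≤ 2 * k → ∑ i, cvec k (l + 1) i * yvec k j i =
      P * (k - 1) - (j - k - 1) + 3 * k * B := by
    intro j h1 h2
    have h3 : ¬ j ≤ k := by omega
    rw [sum_blocks_mul_yvec k j (j - k - 1) (2 * k - j) P A B _ hc (by omega)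
      (by rw [if_neg h3]; omega), if_neg h3, Nat.cast_sub (by omega), Nat.cast_sub (by omega)]
    push_cast
    ring
  have low_step : ∀ j, 1 ≤ j → j ≤ k - 1 →
      ∑ i, cvec k (l + 1) i * yvec k (j + 1) i < ∑ i, cvec k (l + 1) i * yvec k j i := by
    intro j h1 h2
    rw [low (j + 1) (by omega) (by omega), low j h1 (by omega)]
    push_cast
    linarith
  have high_step : ∀ j, k + 1 ≤ j → j ≤ 2 * k - 1 →
      ∑ i, cvec k (l + 1) i * yvec k (j + 1) i < ∑ i, cvec k (l + 1) i * yvec k j i := by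
    intro j h1 h2
    rw [high (j + 1) (by omega) (by omega), high j h1 (by omega)]
    push_cast
    linarith
  have odd_step : Odd (l + 1) →
      ∑ i, cvec k (l + 1) i * yvec k (k + 1) i < ∑ i, cvec k (l + 1) i * yvec k k i := by
    intro h
    rw [high (k + 1) le_rfl (by omega), low k hk le_rfl]
    push_cast
    linear_combination (k : ℤ) * ho h
  refine ⟨fun h j h1 h2 => ?_, fun _ h => ⟨?_, high_step⟩, fun _ h => ⟨odd_step h, low_step⟩⟩
  · rcases lt_trichotomy j k with hj | rfl | hj
    · exact low_step j h1 (by omega)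
    · exact odd_step (by rw [h]; exact odd_one)
    · exact high_step j hj h2
  · rw [low 1 le_rfl hk, high (2 * k) (by omega) le_rfl]
    push_cast
    linear_combination -(k : ℤ) * he h
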